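/- There exists no hyperfocused 14-arc in PG(2,32). -/

import Mathlib

open scoped LinearAlgebra.Projectivization

/-- The projective plane over a field `F`. -/
abbrev PG2 (F : Type*) [Field F] := Projectivization F (Fin 3 → F)

variable {F : Type*} [Field F]

/-- A line of `PG2 F`: the zero set of a nonzero linear form. -/
def IsLine (l : Set (PG2 F)) : Prop :=
  ∃ f : (Fin 3 → F) →ₗ[F] F, f ≠ 0 ∧ l = {P : PG2 F | f P.rep = 0}

/-- Three points of `PG2 F` are collinear if some line contains them all. -/
def Collinear3 (A B C : PG2 F) : Prop :=
  ∃ l : Set (PG2 F), IsLine l ∧ A ∈ l ∧ B ∈ l ∧ C ∈ l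

/-- An arc: a set of points no three of which are collinear, i.e. every line
meets it in at most two points. -/
def IsArc (K : Set (PG2 F)) : Prop :=
  ∀ l : Set (PG2 F), IsLine l → (K ∩ l).ncard ≤ 2

/-- A secant (chord) of `K`: a line containing at least two points of `K`. -/
def IsSecant (K l : Set (PG2 F)) : Prop :=
  IsLine l ∧ 2 ≤ (K ∩ l).ncard

/-- A blocking set of the secants of `K`: a set of points disjoint from `K`
meeting every secant of `K`. -/
def IsBlockingSet (K B : Set (PG2 F)) : Prop :=
  B ∩ K = ∅ ∧ ∀ l : Set (PG2 F), IsSecant K l → (B ∩ l).Nonempty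

/-- The focus set of `K` on `l`: the points of `l` lying on some secant of `K`. -/
def FocusSet (K l : Set (PG2 F)) : Set (PG2 F) :=
  {P : PG2 F | P ∈ l ∧ ∃ m : Set (PG2 F), IsSecant K m ∧ P ∈ m}

/-- `K` is hyperfocused on the exterior line `l` if the secants of `K` meet `l`
in exactly `|K| - 1` points. -/
def Hyperfocused (K l : Set (PG2 F)) : Prop :=
  IsLine l ∧ K ∩ l = ∅ ∧ (FocusSet K l).ncard = K.ncard - 1

/-- `K` is sharply focused on the exterior line `l` if the secants of `K` meet `l`
in exactly `|K|` points. -/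
def SharplyFocused (K l : Set (PG2 F)) : Prop :=
  IsLine l ∧ K ∩ l = ∅ ∧ (FocusSet K l).ncard = K.ncard

/-- A conic: the zero set of an irreducible homogeneous quadratic form. -/
def IsConic (C : Set (PG2 F)) : Prop :=
  ∃ Q : MvPolynomial (Fin 3) F, Q.IsHomogeneous 2 ∧ Irreducible Q ∧
    C = {P : PG2 F | MvPolynomial.eval P.rep Q = 0}

/-- A tangent line to a point set `C`: a line meeting `C` in exactly one point. -/
def IsTangentLine (C l : Set (PG2 F)) : Prop :=
  IsLine l ∧ (C ∩ l).ncard = 1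

/-- A projectivity of `PG2 F`: a map induced by a linear automorphism. -/
def IsProjectivity (φ : PG2 F → PG2 F) : Prop :=
  ∃ g : (Fin 3 → F) ≃ₗ[F] (Fin 3 → F),
    ∀ P : PG2 F, φ P = Projectivization.map g.toLinearMap g.injective P

lemma mk3_ne_zero {a b c : F} (h : a ≠ 0 ∨ b ≠ 0 ∨ c ≠ 0) :
    (![a, b, c] : Fin 3 → F) ≠ 0 := by
  intro hv
  rcases h with h | h | h
  · exact h (by simpa using congrFun hv 0)
  · exact h (by simpa using congrFun hv 1)
  · exact h (by simpa using congrFun hv 2)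

/-- The point of `PG2 F` with homogeneous coordinates `(a, b, c)`. -/
def pt (a b c : F) (h : (![a, b, c] : Fin 3 → F) ≠ 0) : PG2 F :=
  Projectivization.mk F ![a, b, c] h

/-- The linear automorphism `(X₁, X₂, X₃) ↦ (X₁ + a₁·X₃, X₂ + a₂·X₃, X₃)`. -/
def tEquiv (A : F × F) : (Fin 3 → F) ≃ₗ[F] (Fin 3 → F) where
  toFun v := ![v 0 + A.1 * v 2, v 1 + A.2 * v 2, v 2]
  invFun v := ![v 0 - A.1 * v 2, v 1 - A.2 * v 2, v 2]
  left_inv v := by funext i; fin_cases i <;> simp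
  right_inv v := by funext i; fin_cases i <;> simp
  map_add' u v := by funext i; fin_cases i <;> simp <;> ring
  map_smul' c v := by funext i; fin_cases i <;> simp <;> ring

/-- The projectivity `φ_A` of `PG2 F` induced by `tEquiv A`. -/
def tφ (A : F × F) : PG2 F → PG2 F :=
  Projectivization.map (tEquiv A).toLinearMap (tEquiv A).injective

/-- The orbit `K_G(P)` of a point `P` under the translation group `T_G`. -/
def tOrbit (G : AddSubgroup (F × F)) (P : PG2 F) : Set (PG2 F) :=
  {Q : PG2 F | ∃ A ∈ G, Q = tφ A P}

/-- A translation arc: an arc which is an orbit `K_G(P)`. -/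
def IsTranslationArc (K : Set (PG2 F)) : Prop :=
  IsArc K ∧ ∃ (G : AddSubgroup (F × F)) (P : PG2 F), K = tOrbit G P

section

open Polynomial

/-- The product `f` of the linear factors at 14 elements of `𝔽₃₂` cannot be of the form `g² + c X`:
writing `X³² + X = f q`, the derivative gives `f² q' = c X³² + c X + f`, and the coefficients at
`X³⁰` and `X¹⁴` are incompatible. -/
theorem exists_odd_coeff_prod_X_add_C_ne_zero {F : Type*} [Field F] [Fintype F] [CharP F 2]
    (hF : Fintype.card F = 32) (s : Finset F) (hs : s.card = 14) :
    ∃ n, Odd n ∧ 3 ≤ n ∧ (∏ a ∈ s, (X + C a)).coeff n ≠ 0 := by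
  by_contra! hodd
  set f : F[X] := ∏ a ∈ s, (X + C a) with hf
  have hmon : f.Monic := monic_prod_of_monic _ _ fun a _ => monic_X_add_C a
  have hdeg : f.natDegree = 14 := by
    rw [hf, natDegree_prod_of_monic _ _ fun a _ => monic_X_add_C a]; simp [hs]
  have hcast : ∀ n : ℕ, Even n → (n : F) = 0 := fun n hn =>
    (CharP.cast_eq_zero_iff F 2 n).2 hn.two_dvd
  have hdvd : f ∣ X ^ 32 + X := by
    have h3 : (X ^ 32 + X : F[X]) = X ^ 32 - X := (CharTwo.sub_eq_add _ _).symm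
    rw [h3]
    refine Finset.prod_dvd_of_coprime ?_ ?_
    · intro a _ b _ hab
      have := pairwise_coprime_X_sub_C (K := F) (s := id) Function.injective_id hab
      simpa [CharTwo.sub_eq_add] using this
    · intro a _
      rw [← CharTwo.sub_eq_add, dvd_iff_isRoot]
      have := FiniteField.pow_card a
      rw [hF] at this
      simp [this]
  obtain ⟨q, hq⟩ := hdvd
  have hder : derivative f = C (f.coeff 1) := by
    ext n
    rw [coeff_derivative, coeff_C]
    rcases n with _ | n
    · simp
    · rcases Nat.even_or_odd (n + 1 + 1) with h | h
      · have := hcast _ h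
        push_cast at this ⊢
        simp [this]
      · rw [hodd _ h (by rcases h with ⟨k, hk⟩; omega)]; simp
  set c := f.coeff 1
  set v := derivative q with hv
  have hvodd : ∀ n, Odd n → v.coeff n = 0 := by
    intro n hn
    have := hcast (n + 1) hn.add_one
    push_cast at this
    rw [hv, coeff_derivative, this, mul_zero]
  have h1 : C c * q + f * v = 1 := by
    have := congrArg derivative hq
    rw [derivative_mul, hder] at this
    rw [← this]
    have h32 : ((32 : ℕ) : F) = 0 := hcast 32 (by decide)
    simp only [derivative_add, derivative_X_pow, derivative_X, h32]
    simp
  have hmain : f ^ 2 * v = C c * X ^ 32 + C c * X + f := by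
    have e1 : f * (C c * q + f * v) = f := by rw [h1, mul_one]
    have e2 : f ^ 2 * v = f - C c * (f * q) := by linear_combination e1
    rw [e2, ← hq, CharTwo.sub_eq_add]; ring
  have hsq : ∀ n, (f ^ 2).coeff n = if 2 ∣ n then f.coeff (n / 2) ^ 2 else 0 := by
    intro n
    rw [← map_frobenius_expand 2 f, coeff_map, coeff_expand (by norm_num)]
    split_ifs <;> simp [frobenius_def]
  have hvdeg : v.natDegree ≤ 4 := by
    rcases eq_or_ne v 0 with h0 | h0
    · simp [h0]
    have := (hmon.pow 2).natDegree_mul' h0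
    rw [hmon.natDegree_pow, hdeg, hmain] at this
    have hle : (C c * X ^ 32 + C c * X + f).natDegree ≤ 32 := by
      refine natDegree_add_le_of_degree_le (natDegree_add_le_of_degree_le ?_ ?_) (by omega)
      · exact natDegree_C_mul_X_pow_le _ _
      · exact (natDegree_C_mul_le _ _).trans (by simp)
    omega
  have hvform : v = C (v.coeff 0) + C (v.coeff 2) * X ^ 2 + C (v.coeff 4) * X ^ 4 := by
    conv_lhs => rw [v.as_sum_range_C_mul_X_pow' (show v.natDegree < 5 by omega)]
    simp [Finset.sum_range_succ, hvodd 1 (by decide), hvodd 3 (by decide)]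
  have hlead : f.coeff 14 = 1 := by rw [← hdeg]; exact hmon
  have hbig : ∀ n, 14 < n → f.coeff n = 0 := fun n hn =>
    coeff_eq_zero_of_natDegree_lt (by omega)
  have hcoeff : ∀ n, 4 ≤ n → (f ^ 2).coeff n * v.coeff 0 + (f ^ 2).coeff (n - 2) * v.coeff 2
      + (f ^ 2).coeff (n - 4) * v.coeff 4 = (C c * X ^ 32 + C c * X + f).coeff n := by
    intro n hn
    rw [← hmain]
    conv_rhs => rw [hvform]
    simp only [mul_add, coeff_add, ← mul_assoc, mul_comm (f ^ 2) (C _)]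
    simp only [mul_assoc, coeff_C_mul, coeff_mul_X_pow', hn, show 2 ≤ n by omega, if_true]
    ring
  have hv2 : v.coeff 2 = 0 := by
    have := hcoeff 30 (by norm_num)
    simpa [hsq, hbig, hlead, hodd 13 (by decide), coeff_X, coeff_X_pow] using this
  have := hcoeff 14 (by norm_num)
  simp [hsq, hlead, hodd 7 (by decide), hodd 5 (by decide), hv2, coeff_X_pow] at this

theorem coeff_sq_eq_zero_of_odd {F : Type*} [Field F] [CharP F 2] (g : F[X]) {n : ℕ}
    (hn : Odd n) : (g ^ 2).coeff n = 0 := by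
  rw [← map_frobenius_expand 2 g, coeff_map, coeff_expand (by norm_num),
    if_neg (by rcases hn with ⟨k, hk⟩; omega), map_zero]

theorem prod_X_add_C_eq_sq {F ι : Type*} [Field F] [DecidableEq F] (S : Finset ι) (u : ι → F)
    (h : ∀ i ∈ S, (S.filter fun j => u j = u i).card = 2) :
    ∃ g : F[X], ∏ i ∈ S, (X + C (u i)) = g ^ 2 := by
  refine ⟨∏ b ∈ S.image u, (X + C b), ?_⟩
  rw [Finset.prod_comp (fun b : F => X + C b) u, ← Finset.prod_pow]
  refine Finset.prod_congr rfl fun b hb => ?_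
  obtain ⟨i, hi, rfl⟩ := Finset.mem_image.1 hb
  rw [h i hi]

theorem coeff_prod_eq_zero_of_pencil {F ι : Type*} [Field F] (S : Finset ι) (x y : ι → F)
    (D : Finset F) {k : ℕ} (hk : k ≤ S.card)
    (hD : S.card - k < D.card)
    (h : ∀ d ∈ D, (∏ i ∈ S, (X + C (y i + d * x i))).coeff k = 0) :
    (∏ i ∈ S, (X + C (x i))).coeff k = 0 := by
  set m := S.card - k
  let E : F[X] := ∑ t ∈ S.powersetCard m, ∏ i ∈ t, (C (y i) + C (x i) * X)
  have hlin : ∀ i, (C (y i) + C (x i) * X).natDegree ≤ 1 := fun i => by compute_degree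
  have hE : E = 0 := by
    refine eq_zero_of_natDegree_lt_card_of_eval_eq_zero' E D (fun d hd => ?_) ?_
    · have := h d hd
      rw [Finset.prod_X_add_C_coeff _ _ hk] at this
      simpa [E, m, eval_finsetSum, eval_prod, mul_comm d] using this
    · refine lt_of_le_of_lt (natDegree_sum_le_of_forall_le _ _ fun t ht => ?_) hD
      refine (natDegree_prod_le _ _).trans
        ((Finset.sum_le_card_nsmul _ _ 1 fun i _ => hlin i).trans ?_)
      simp [(Finset.mem_powersetCard.1 ht).2, m]
  have hc : E.coeff m = 0 := by rw [hE, coeff_zero]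
  rw [Finset.prod_X_add_C_coeff _ _ hk, ← hc, finsetSum_coeff]
  refine Finset.sum_congr rfl fun t ht => ?_
  have := coeff_prod_of_natDegree_le t (fun i => C (y i) + C (x i) * X) 1 fun i _ => hlin i
  rw [mul_one, (Finset.mem_powersetCard.1 ht).2] at this
  rw [this]
  simp [coeff_C]

theorem no_affine_hyperfocused {F ι : Type*} [Field F] [Fintype F] (hF : Fintype.card F = 32)
    (S : Finset ι) (hS : S.card = 14) (x y : ι → F) (hx : Set.InjOn x S)
    (D : Finset F) (hD : D.card ≤ 13)
    (hmem : ∀ d, ∀ i ∈ S, ∀ j ∈ S, i ≠ j → y i + d * x i = y j + d * x j → d ∈ D)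
    (harc : ∀ d, ∀ i ∈ S, ∀ j ∈ S, ∀ k ∈ S, i ≠ j → i ≠ k → j ≠ k →
      y i + d * x i = y j + d * x j → y i + d * x i ≠ y k + d * x k) : False := by
  classical
  have : CharP F 2 := by
    have h : ((32 : ℕ) : F) = 0 := by rw [← hF]; exact Nat.cast_card_eq_zero F
    refine CharTwo.of_one_ne_zero_of_two_eq_zero one_ne_zero ?_
    have h5 : (2 : F) ^ 5 = 0 := by rw [← h]; norm_num
    exact pow_eq_zero_iff (by norm_num) |>.1 h5
  let slope : ι → ι → F := fun i j => -(y i - y j) / (x i - x j)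
  have hxne : ∀ i ∈ S, ∀ j ∈ S, i ≠ j → x i - x j ≠ 0 := fun i hi j hj hij h =>
    hij (hx hi hj (sub_eq_zero.1 h))
  have hslope : ∀ i ∈ S, ∀ j ∈ S, i ≠ j → y i + slope i j * x i = y j + slope i j * x j := by
    intro i hi j hj hij
    have := hxne i hi j hj hij
    have h2 : slope i j * (x i - x j) = -(y i - y j) := div_mul_cancel₀ _ this
    linear_combination h2
  have hcard : ∀ i ∈ S, (S.erase i).card = 13 := fun i hi => by
    rw [Finset.card_erase_of_mem hi, hS]
  have hmaps : ∀ i ∈ S, Set.MapsTo (slope i) (S.erase i : Finset ι) D := fun i hi j hj => by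
    obtain ⟨hji, hj⟩ := Finset.mem_erase.1 (Finset.mem_coe.1 hj)
    exact hmem _ i hi j hj hji.symm (hslope i hi j hj hji.symm)
  have hinj : ∀ i ∈ S, Set.InjOn (slope i) (S.erase i : Finset ι) := fun i hi j hj k hk hjk => by
    obtain ⟨hji, hj⟩ := Finset.mem_erase.1 (Finset.mem_coe.1 hj)
    obtain ⟨hki, hk⟩ := Finset.mem_erase.1 (Finset.mem_coe.1 hk)
    by_contra hne
    refine harc (slope i j) i hi j hj k hk hji.symm hki.symm hne (hslope i hi j hj hji.symm) ?_
    rw [hjk]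
    exact hslope i hi k hk hki.symm
  have hsq : ∀ d ∈ D, ∃ g : F[X], ∏ i ∈ S, (X + C (y i + d * x i)) = g ^ 2 := by
    intro d hd
    refine prod_X_add_C_eq_sq S _ fun i hi => ?_
    obtain ⟨j, hj, hjd⟩ := Finset.surjOn_of_injOn_of_card_le (slope i) (hmaps i hi) (hinj i hi)
      (by rw [hcard i hi]; exact hD) hd
    obtain ⟨hji, hj⟩ := Finset.mem_erase.1 (Finset.mem_coe.1 hj)
    have hij := hslope i hi j hj hji.symm
    rw [hjd] at hij
    rw [Finset.card_eq_two]
    refine ⟨i, j, hji.symm, Finset.ext fun k => ?_⟩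
    simp only [Finset.mem_filter, Finset.mem_insert, Finset.mem_singleton]
    constructor
    · rintro ⟨hk, hki⟩
      by_contra! hne
      exact harc d i hi j hj k hk hji.symm hne.1.symm hne.2.symm hij hki.symm
    · rintro (rfl | rfl)
      · exact ⟨hi, rfl⟩
      · exact ⟨hj, hij.symm⟩
  have hDcard : 13 ≤ D.card := by
    obtain ⟨i, hi⟩ : S.Nonempty := Finset.card_pos.1 (by omega)
    rw [← hcard i hi]
    exact Finset.card_le_card_of_injOn _ (hmaps i hi) (hinj i hi)
  obtain ⟨n, hn, h3, hne⟩ := exists_odd_coeff_prod_X_add_C_ne_zero hF (S.image x)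
    (by rw [Finset.card_image_of_injOn hx, hS])
  refine hne ?_
  rw [Finset.prod_image hx]
  rcases le_or_gt n S.card with hle | hlt
  · refine coeff_prod_eq_zero_of_pencil S x y D hle (by omega) fun d hd => ?_
    obtain ⟨g, hg⟩ := hsq d hd
    rw [hg, coeff_sq_eq_zero_of_odd g hn]
  · refine coeff_eq_zero_of_natDegree_lt ?_
    rwa [natDegree_prod_of_monic _ _ fun i _ => monic_X_add_C (x i),
      Finset.sum_congr rfl fun i _ => natDegree_X_add_C (x i), ← Finset.card_eq_sum_ones]

end

theorem exists_basis_coord_zero_eq {F : Type*} [Field F] (f : (Fin 3 → F) →ₗ[F] F) (hf : f ≠ 0) :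
    ∃ B : Module.Basis (Fin 3) F (Fin 3 → F), B.coord 0 = f := by
  obtain ⟨e, he⟩ : ∃ e, f e = 1 := LinearMap.surjective hf 1
  have hrank : Module.finrank F (LinearMap.ker f) = 2 := by
    have h1 := f.finrank_range_add_finrank_ker
    rw [LinearMap.range_eq_top.2 (LinearMap.surjective hf), finrank_top, Module.finrank_self,
      Module.finrank_fin_fun] at h1
    omega
  let b := Module.finBasisOfFinrankEq F (LinearMap.ker f) hrank
  have hli : ∀ c : F, ∀ v ∈ LinearMap.ker f, c • e + v = 0 → c = 0 := fun c v hv h => by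
    have h' := congrArg f h
    simpa [he, LinearMap.mem_ker.1 hv] using h'
  have hsp : ∀ z, ∃ c : F, z + c • e ∈ LinearMap.ker f := fun z => ⟨-f z, by simp [he]⟩
  refine ⟨Module.Basis.mkFinCons e b hli hsp, (Module.Basis.mkFinCons e b hli hsp).ext fun i => ?_⟩
  rw [Module.Basis.coord_apply, Module.Basis.repr_self, Module.Basis.coe_mkFinCons]
  refine Fin.cases ?_ (fun j => ?_) i
  · simp [he]
  · have := LinearMap.mem_ker.1 (b j).2
    simp [this]

theorem apply_rep_mk_eq_zero_iff {F V : Type*} [Field F] [AddCommGroup V] [Module F V]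
    (f : V →ₗ[F] F) {v : V} (hv : v ≠ 0) : f (Projectivization.mk F v hv).rep = 0 ↔ f v = 0 := by
  obtain ⟨a, ha⟩ := Projectivization.exists_smul_eq_mk_rep F v hv
  rw [← ha, Units.smul_def, map_smul, smul_eq_mul, mul_eq_zero]
  simp

theorem mem_focusSet_of_apply_eq_zero {F : Type*} [Field F] {K l : Set (PG2 F)} (hK : K.Finite)
    {f : (Fin 3 → F) →ₗ[F] F} {P Q R : PG2 F} (hP : P ∈ K) (hQ : Q ∈ K) (hPQ : P ≠ Q)
    (hR : R ∈ l) (hfP : f P.rep = 0) (hfQ : f Q.rep = 0) (hfR : f R.rep = 0) (hf : f ≠ 0) :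
    R ∈ FocusSet K l :=
  ⟨hR, {P | f P.rep = 0}, ⟨⟨f, hf, rfl⟩, (Set.one_lt_ncard (hK.inter_of_left _)).2
    ⟨P, ⟨hP, hfP⟩, Q, ⟨hQ, hfQ⟩, hPQ⟩⟩, hfR⟩

/-- there exists no hyperfocused 14-arc in `PG(2,32)`. -/
theorem no_hyperfocused_fourteen_arc {F : Type*} [Field F] [Fintype F]
    (hF : Fintype.card F = 32) :
    ¬ ∃ (K l : Set (PG2 F)), IsArc K ∧ K.ncard = 14 ∧ Hyperfocused K l := by
  classical
  rintro ⟨K, l, hK, hcard, ⟨lam, hlam, rfl⟩, hext, hfoc⟩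
  rw [hcard] at hfoc
  have hKfin : K.Finite := Set.finite_of_ncard_ne_zero (by omega)
  have hFfin := Set.finite_of_ncard_ne_zero
    (show (FocusSet K {P | lam P.rep = 0}).ncard ≠ 0 by omega)
  set Φ := FocusSet K {P | lam P.rep = 0}
  have hcount : ∀ v : F → Fin 3 → F, ∀ hv : ∀ t, v t ≠ 0,
      Function.Injective (fun t => Projectivization.mk F (v t) (hv t)) →
      (Finset.univ.filter fun t => Projectivization.mk F (v t) (hv t) ∈ Φ).card ≤ 13 := by
    intro v hv hinj
    calc _ ≤ hFfin.toFinset.card :=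
          Finset.card_le_card_of_injOn _ (fun t ht => by simpa using ht) hinj.injOn
      _ = 13 := by rw [← Set.ncard_eq_toFinset_card _ hFfin, hfoc]
  obtain ⟨B, hB⟩ := exists_basis_coord_zero_eq lam hlam
  have hlam1 : lam (B 1) = 0 := by simp [← hB]
  have hlam2 : lam (B 2) = 0 := by simp [← hB]
  obtain ⟨t, q, hq, hv, ht⟩ : ∃ (t : F) (q : Fin 3 → F), q = B 1 + t • B 2 ∧
      ∃ hv : q ≠ 0, Projectivization.mk F q hv ∉ Φ := by
    have hv : ∀ t : F, B 1 + t • B 2 ≠ 0 := fun t h => by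
      simpa using congrArg (B.coord 1) h
    have hle := hcount (fun t => B 1 + t • B 2) hv fun s t hst => by
      obtain ⟨a, ha⟩ := (Projectivization.mk_eq_mk_iff' ..).1 hst
      have h1 : a = 1 := by simpa using congrArg (B.coord 1) ha
      have h2 : a * t = s := by simpa using congrArg (B.coord 2) ha
      rw [← h2, h1, one_mul]
    by_contra! h
    rw [Finset.filter_true_of_mem fun t _ => h t _ rfl (hv t), Finset.card_univ, hF] at hle
    omega
  let α := B.coord 2 - t • B.coord 1
  let β := B.coord 1
  have hαq : α q = 0 := by simp [α, hq]
  have hβq : β q = 1 := by simp [β, hq]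
  have hαr : α (B 2) = 1 := by simp [α]
  have hβr : β (B 2) = 0 := by simp [β]
  have hlq : lam q = 0 := by simp [hq, hlam1, hlam2]
  clear_value α β
  let x : PG2 F → F := fun P => α P.rep / lam P.rep
  let y : PG2 F → F := fun P => β P.rep / lam P.rep
  have hne : ∀ P ∈ K, lam P.rep ≠ 0 := fun P hP h =>
    (Set.ext_iff.1 hext P).1 ⟨hP, h⟩
  have hx : ∀ P ∈ K, ∀ c, x P = c → (α - c • lam) P.rep = 0 := by
    rintro P hP c rfl
    simp [x, hne P hP]
  have hy : ∀ P ∈ K, ∀ d c, y P + d * x P = c → (β + d • α - c • lam) P.rep = 0 := by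
    rintro P hP d c rfl
    have := hne P hP
    simp only [x, y, LinearMap.sub_apply, LinearMap.add_apply, LinearMap.smul_apply, smul_eq_mul]
    field_simp
    ring
  have hline : ∀ d c : F, β + d • α - c • lam ≠ 0 := fun d c h => by
    simpa [hβq, hαq, hlq] using LinearMap.congr_fun h q
  have hr : ∀ d : F, B 2 - d • q ≠ 0 := fun d h => by
    simpa [hαr, hαq] using congrArg α h
  refine no_affine_hyperfocused hF hKfin.toFinset
    (by rw [← Set.ncard_eq_toFinset_card _ hKfin, hcard]) x y ?_
    (Finset.univ.filter fun d => Projectivization.mk F (B 2 - d • q) (hr d) ∈ Φ) ?_ ?_ ?_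
  · intro P hP Q hQ hPQ
    simp only [Set.Finite.coe_toFinset] at hP hQ
    by_contra hne'
    refine ht (mem_focusSet_of_apply_eq_zero hKfin hP hQ hne' ?_ (hx P hP _ rfl)
      (hx Q hQ _ hPQ.symm) ?_ fun h => ?_)
    · exact (apply_rep_mk_eq_zero_iff lam hv).2 hlq
    · exact (apply_rep_mk_eq_zero_iff _ hv).2 (by simp [hαq, hlq])
    · simpa [hαr, hlam2] using LinearMap.congr_fun h (B 2)
  · refine hcount _ hr fun c d hcd => ?_
    obtain ⟨a, ha⟩ := (Projectivization.mk_eq_mk_iff' ..).1 hcd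
    have h1 : a = 1 := by simpa [hαr, hαq] using congrArg α ha
    simpa [hβr, hβq, h1] using (congrArg β ha).symm
  · intro d P hP Q hQ hPQ h
    simp only [Set.Finite.mem_toFinset] at hP hQ
    simp only [Finset.mem_filter, Finset.mem_univ, true_and]
    refine mem_focusSet_of_apply_eq_zero hKfin hP hQ hPQ ?_ (hy P hP d _ rfl)
      (hy Q hQ d _ h.symm) ?_ (hline d _)
    · exact (apply_rep_mk_eq_zero_iff lam _).2 (by simp [hlam2, hlq])
    · exact (apply_rep_mk_eq_zero_iff _ _).2 (by simp [hαr, hαq, hβr, hβq, hlq, hlam2])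
  · intro d P hP Q hQ R hR hPQ hPR hQR h h'
    simp only [Set.Finite.mem_toFinset] at hP hQ hR
    refine (hK _ ⟨_, hline d (y P + d * x P), rfl⟩).not_gt
      ((Set.two_lt_ncard (hKfin.inter_of_left _)).2 ?_)
    exact ⟨P, ⟨hP, hy P hP d _ rfl⟩, Q, ⟨hQ, hy Q hQ d _ h.symm⟩, R, ⟨hR, hy R hR d _ h'.symm⟩,
      hPQ, hPR, hQR⟩
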